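/- For every oracle A ⊆ ℕ the following are equivalent: (i) there is a function f ≤_T A that eventually disagrees with every computable function, i.e., for every total computable h : ℕ → ℕ one has f(n) ≠ h(n) for all but finitely many n (that is, A is in ℬ(≠*)); (ii) A is weakly meager engulfing. -/

import Mathlib

open Filter

namespace CichonAnalog

/-! ### Oracle computability -/

/-- Partial functions `ℕ →. ℕ` partial recursive relative to the oracle `A ⊆ ℕ`.
This is Mathlib's `Nat.Partrec` with an extra base case for the characteristic
function of the oracle. -/
inductive RecursiveIn (A : Set ℕ) : (ℕ →. ℕ) → Prop
  | zero : RecursiveIn A (pure 0)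
  | succ : RecursiveIn A ↑Nat.succ
  | left : RecursiveIn A ↑fun n : ℕ => n.unpair.1
  | right : RecursiveIn A ↑fun n : ℕ => n.unpair.2
  | oracle : RecursiveIn A ↑fun n : ℕ => A.indicator (fun _ => 1) n
  | pair {f g} : RecursiveIn A f → RecursiveIn A g →
      RecursiveIn A fun n => Nat.pair <$> f n <*> g n
  | comp {f g} : RecursiveIn A f → RecursiveIn A g →
      RecursiveIn A fun n => g n >>= f
  | prec {f g} : RecursiveIn A f → RecursiveIn A g →
      RecursiveIn A (Nat.unpaired fun a n =>
        n.rec (f a) fun y IH => do let i ← IH; g (Nat.pair a (Nat.pair y i)))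
  | rfind {f} : RecursiveIn A f →
      RecursiveIn A fun a => Nat.rfind fun n => (fun m => m = 0) <$> f (Nat.pair a n)

/-- The partial function `f` (between coded spaces) is partial recursive in the oracle `A`. -/
def PartrecIn (A : Set ℕ) {α σ : Type} [Primcodable α] [Primcodable σ] (f : α →. σ) : Prop :=
  RecursiveIn A fun n =>
    Part.bind ↑(Encodable.decode (α := α) n) fun a => (f a).map Encodable.encode

/-- `f ≤_T A` : the (total) function `f` is computable from the oracle `A`. -/
def ComputableIn (A : Set ℕ) {α σ : Type} [Primcodable α] [Primcodable σ] (f : α → σ) : Prop :=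
  PartrecIn A (f : α →. σ)

/-- `W` is computably enumerable in the oracle `A`. -/
def CEIn (A : Set ℕ) {α : Type} [Primcodable α] (W : Set α) : Prop :=
  ∃ f : α →. ℕ, PartrecIn A f ∧ ∀ a, a ∈ W ↔ (f a).Dom

/-- `W` is computably enumerable (unrelativized). -/
def CE {α : Type} [Primcodable α] (W : Set α) : Prop :=
  ∃ f : α →. ℕ, Partrec f ∧ ∀ a, a ∈ W ↔ (f a).Dom

/-! ### Cantor space, `Π⁰₁` classes, effective meagerness -/

/-- The basic clopen set (cylinder) of the finite binary string `σ` in Cantor space. -/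
def Cyl (σ : List Bool) : Set (ℕ → Bool) :=
  {x | ∀ i, i < σ.length → x i = σ.getD i false}

/-- `P` is a `Π⁰₁(A)` class: a closed subset of Cantor space whose complement is the
union of basic clopen sets over a set of strings c.e. in `A`. -/
def Pi01In (A : Set ℕ) (P : Set (ℕ → Bool)) : Prop :=
  ∃ W : Set (List Bool), CEIn A W ∧ P = (⋃ σ ∈ W, Cyl σ)ᶜ

/-- `P` is a (plain) `Π⁰₁` class. -/
def Pi01 (P : Set (ℕ → Bool)) : Prop :=
  ∃ W : Set (List Bool), CE W ∧ P = (⋃ σ ∈ W, Cyl σ)ᶜ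

/-- `C` is a uniformly `Π⁰₁(A)` sequence of classes. -/
def UnifPi01In (A : Set ℕ) (C : ℕ → Set (ℕ → Bool)) : Prop :=
  ∃ W : Set (ℕ × List Bool), CEIn A W ∧
    ∀ m, C m = (⋃ σ ∈ {s | (m, s) ∈ W}, Cyl σ)ᶜ

/-- `C` is a uniformly `Π⁰₁` sequence of classes. -/
def UnifPi01 (C : ℕ → Set (ℕ → Bool)) : Prop :=
  ∃ W : Set (ℕ × List Bool), CE W ∧
    ∀ m, C m = (⋃ σ ∈ {s | (m, s) ∈ W}, Cyl σ)ᶜ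

/-- `S` is effectively meager relative to `A`: it is contained in the union of a
uniformly `Π⁰₁(A)` sequence of nowhere dense classes. -/
def EffMeagerIn (A : Set ℕ) (S : Set (ℕ → Bool)) : Prop :=
  ∃ C : ℕ → Set (ℕ → Bool), UnifPi01In A C ∧ (∀ m, IsNowhereDense (C m)) ∧ S ⊆ ⋃ m, C m

/-- `S` is effectively meager (unrelativized). -/
def EffMeager (S : Set (ℕ → Bool)) : Prop :=
  ∃ C : ℕ → Set (ℕ → Bool), UnifPi01 C ∧ (∀ m, IsNowhereDense (C m)) ∧ S ⊆ ⋃ m, C m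

/-- `A` is meager engulfing: some `A`-effectively meager set contains every
effectively meager set. -/
def MeagerEngulfing (A : Set ℕ) : Prop :=
  ∃ S, EffMeagerIn A S ∧ ∀ T, EffMeager T → T ⊆ S

/-- `A` is weakly meager engulfing: some `A`-effectively meager set contains every
computable element of Cantor space. -/
def WeaklyMeagerEngulfing (A : Set ℕ) : Prop :=
  ∃ S, EffMeagerIn A S ∧ ∀ x : ℕ → Bool, Computable x → x ∈ S

/-- `V` is a computable set of finite binary strings. -/
def ComputableStringSet (V : Set (List Bool)) : Prop :=
  ∃ χ : List Bool → Bool, Computable χ ∧ ∀ s, s ∈ V ↔ χ s = true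

/-- `V` is a dense set of finite binary strings: every string has an extension in `V`. -/
def DenseStringSet (V : Set (List Bool)) : Prop :=
  ∀ σ : List Bool, ∃ τ ∈ V, σ <+: τ

/-- `x ∈ 2^ω` is weakly 1-generic: for every computable dense set `V` of finite
binary strings, some initial segment of `x` lies in `V`. -/
def Weakly1Generic (x : ℕ → Bool) : Prop :=
  ∀ V : Set (List Bool), ComputableStringSet V → DenseStringSet V →
    ∃ n, (List.ofFn fun i : Fin n => x i) ∈ V

/-! ### Domination properties -/

/-- `A` is high: `A` computes a function dominating every total computable function. -/
def High (A : Set ℕ) : Prop :=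
  ∃ f : ℕ → ℕ, ComputableIn A f ∧
    ∀ g : ℕ → ℕ, Computable g → ∀ᶠ n in atTop, g n ≤ f n

/-- `A` is of hyperimmune degree: `A` computes a function not dominated by any
computable function. -/
def HyperimmuneDegree (A : Set ℕ) : Prop :=
  ∃ f : ℕ → ℕ, ComputableIn A f ∧
    ∀ g : ℕ → ℕ, Computable g → ∃ᶠ n in atTop, g n < f n

/-- `A` is of hyperimmune-free degree: every function computable in `A` is dominated
by a total computable function. -/
def HyperimmuneFree (A : Set ℕ) : Prop :=
  ∀ f : ℕ → ℕ, ComputableIn A f →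
    ∃ g : ℕ → ℕ, Computable g ∧ ∀ᶠ n in atTop, f n ≤ g n

/-! ### Measure on Cantor space, Kurtz and Schnorr tests -/

open scoped Classical in
/-- The uniform measure of the clopen set `⋃ σ ∈ F, [σ]` determined by the finite
list `F` of binary strings: count the binary strings of maximal length extending
some member of `F`, and normalize. -/
noncomputable def listMeasure (F : List (List Bool)) : ℚ :=
  letI k := (F.map List.length).foldr max 0
  ((Finset.univ.filter fun v : Fin k → Bool =>
      ∃ σ ∈ F, σ <+: List.ofFn v).card : ℚ) / 2 ^ k

/-- The clopen subset of Cantor space given explicitly as a finite union of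
basic clopen sets. -/
def ClopSet (F : List (List Bool)) : Set (ℕ → Bool) := ⋃ σ ∈ F, Cyl σ

/-- The effectively open subset of Cantor space enumerated by the sequence of
finite stages `g`. -/
def OpenSet (g : ℕ → List (List Bool)) : Set (ℕ → Bool) := ⋃ s, ClopSet (g s)

/-- The measure of the open set enumerated by the stages `g`: the supremum of the
measures of its finite partial unions. -/
noncomputable def openMeasure (g : ℕ → List (List Bool)) : ℝ :=
  ⨆ s : ℕ, (listMeasure ((List.range (s + 1)).flatMap g) : ℝ)

/-- A Kurtz test relative to `A`: an `A`-computable sequence of explicitly given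
clopen sets, the `m`-th of measure at most `2 ^ (-m)`. -/
def KurtzTestIn (A : Set ℕ) (G : ℕ → List (List Bool)) : Prop :=
  ComputableIn A G ∧ ∀ m, listMeasure (G m) ≤ (1 / 2) ^ m

/-- A (plain) Kurtz test. -/
def KurtzTest (G : ℕ → List (List Bool)) : Prop :=
  Computable G ∧ ∀ m, listMeasure (G m) ≤ (1 / 2) ^ m

/-- A Schnorr test relative to `A`: an `A`-computable doubly indexed sequence of finite
stages such that the `m`-th effectively open set `⋃ s, ClopSet (g m s)` has measure at
most `2 ^ (-m)`, and this measure is a real computable in `A` uniformly in `m`. -/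
def SchnorrTestIn (A : Set ℕ) (g : ℕ → ℕ → List (List Bool)) : Prop :=
  ComputableIn A (fun p : ℕ × ℕ => g p.1 p.2) ∧
  (∀ m, openMeasure (g m) ≤ (1 / 2) ^ m) ∧
  ∃ q : ℕ × ℕ → ℚ, ComputableIn A q ∧
    ∀ m k, |openMeasure (g m) - (q (m, k) : ℝ)| ≤ (1 / 2) ^ k

/-- A (plain) Schnorr test. -/
def SchnorrTest (g : ℕ → ℕ → List (List Bool)) : Prop :=
  Computable (fun p : ℕ × ℕ => g p.1 p.2) ∧
  (∀ m, openMeasure (g m) ≤ (1 / 2) ^ m) ∧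
  ∃ q : ℕ × ℕ → ℚ, Computable q ∧
    ∀ m k, |openMeasure (g m) - (q (m, k) : ℝ)| ≤ (1 / 2) ^ k

/-- `N` is Schnorr null relative to `A`. -/
def SchnorrNullIn (A : Set ℕ) (N : Set (ℕ → Bool)) : Prop :=
  ∃ g, SchnorrTestIn A g ∧ N ⊆ ⋂ m, OpenSet (g m)

/-- `N` is Schnorr null (unrelativized). -/
def SchnorrNull (N : Set (ℕ → Bool)) : Prop :=
  ∃ g, SchnorrTest g ∧ N ⊆ ⋂ m, OpenSet (g m)

/-- `x ∈ 2^ω` is Schnorr random: it belongs to no Schnorr null set. -/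
def SchnorrRandom (x : ℕ → Bool) : Prop := ∀ N, SchnorrNull N → x ∉ N

/-- `A` is Kurtz engulfing: there is an `A`-computable sequence of Kurtz tests relative
to `A` such that every Kurtz null set is contained in the null set of one of them. -/
def KurtzEngulfing (A : Set ℕ) : Prop :=
  ∃ G : ℕ → ℕ → List (List Bool),
    ComputableIn A (fun p : ℕ × ℕ => G p.1 p.2) ∧
    (∀ i m, listMeasure (G i m) ≤ (1 / 2) ^ m) ∧
    ∀ L, KurtzTest L → ∃ i, (⋂ m, ClopSet (L m)) ⊆ ⋂ m, ClopSet (G i m)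

/-- `A` is weakly Kurtz engulfing: there is an `A`-computable sequence of Kurtz tests
relative to `A` such that the union of their null sets contains every computable
element of Cantor space. -/
def WeaklyKurtzEngulfing (A : Set ℕ) : Prop :=
  ∃ G : ℕ → ℕ → List (List Bool),
    ComputableIn A (fun p : ℕ × ℕ => G p.1 p.2) ∧
    (∀ i m, listMeasure (G i m) ≤ (1 / 2) ^ m) ∧
    ∀ x : ℕ → Bool, Computable x → ∃ i, x ∈ ⋂ m, ClopSet (G i m)

/-- `A` is weakly Schnorr engulfing: some set Schnorr null relative to `A` contains
every computable element of Cantor space. -/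
def WeaklySchnorrEngulfing (A : Set ℕ) : Prop :=
  ∃ N, SchnorrNullIn A N ∧ ∀ x : ℕ → Bool, Computable x → x ∈ N

/-! ### DNR and PA degrees -/

/-- The `e`-th partial computable function. -/
noncomputable def phi (e : ℕ) : ℕ →. ℕ := (Denumerable.ofNat Nat.Partrec.Code e).eval

/-- `h` is diagonally nonrecursive. -/
def DNRFun (h : ℕ → ℕ) : Prop := ∀ e, ∀ y ∈ phi e e, h e ≠ y

/-- `A` is DNR: `A` computes a diagonally nonrecursive function. -/
def DNRDegree (A : Set ℕ) : Prop := ∃ h : ℕ → ℕ, ComputableIn A h ∧ DNRFun h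

/-- `A` is PA: `A` computes a `{0,1}`-valued diagonally nonrecursive function. -/
def PA (A : Set ℕ) : Prop :=
  ∃ h : ℕ → ℕ, ComputableIn A h ∧ (∀ e, h e ≤ 1) ∧ DNRFun h

/-! ### Traces -/

/-- The trace `σ` (satisfying `|σ n| ≤ n`) traces the function `f` if
`f n ∈ σ n` for all but finitely many `n`. -/
def Traces (σ : ℕ → Finset ℕ) (f : ℕ → ℕ) : Prop := ∀ᶠ n in atTop, f n ∈ σ n

/-- `σ` is a `(D, g)`-trace relative to `A`: `D` is infinite and c.e. in `A`, `g` is a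
partial `A`-computable function with `D ⊆ dom g` and `g n ≥ n` on its domain, and `σ`
is partial `A`-computable, defined on `D`, with `|σ n| < g n` for all `n ∈ D`. -/
def IsDGTraceIn (A : Set ℕ) (D : Set ℕ) (g : ℕ →. ℕ) (σ : ℕ →. Finset ℕ) : Prop :=
  D.Infinite ∧ CEIn A D ∧ PartrecIn A g ∧ D ⊆ g.Dom ∧ (∀ n, ∀ y ∈ g n, n ≤ y) ∧
  PartrecIn A σ ∧ D ⊆ σ.Dom ∧ ∀ n ∈ D, ∀ S ∈ σ n, ∀ b ∈ g n, S.card < b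

/-- `σ` is a `(D, g)`-trace (unrelativized). -/
def IsDGTrace (D : Set ℕ) (g : ℕ →. ℕ) (σ : ℕ →. Finset ℕ) : Prop :=
  D.Infinite ∧ CE D ∧ Partrec g ∧ D ⊆ g.Dom ∧ (∀ n, ∀ y ∈ g n, n ≤ y) ∧
  Partrec σ ∧ D ⊆ σ.Dom ∧ ∀ n ∈ D, ∀ S ∈ σ n, ∀ b ∈ g n, S.card < b

/-- The `(D, g)`-trace `σ` traces `f`: `f n ∈ σ n` for all but finitely many `n ∈ D`. -/
def DGTraces (D : Set ℕ) (σ : ℕ →. Finset ℕ) (f : ℕ → ℕ) : Prop :=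
  ∀ᶠ n in atTop, n ∈ D → ∀ S ∈ σ n, f n ∈ S


section OracleComputability

variable {A : Set ℕ} {α β γ σ : Type} [Primcodable α] [Primcodable β] [Primcodable γ]
  [Primcodable σ]

open Encodable

theorem RecursiveIn.of_partrec {f : ℕ →. ℕ} (hf : Nat.Partrec f) : RecursiveIn A f := by
  induction hf with
  | zero | succ | left | right => constructor
  | pair _ _ ih₁ ih₂ => exact .pair ih₁ ih₂
  | comp _ _ ih₁ ih₂ => exact .comp ih₁ ih₂
  | prec _ _ ih₁ ih₂ => exact .prec ih₁ ih₂
  | rfind _ ih => exact .rfind ih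

theorem RecursiveIn.of_eq {f g : ℕ →. ℕ} (hf : RecursiveIn A f) (H : ∀ n, f n = g n) :
    RecursiveIn A g :=
  (funext H : f = g) ▸ hf

theorem PartrecIn.of_eq {f g : α →. σ} (hf : PartrecIn A f) (H : ∀ n, f n = g n) :
    PartrecIn A g :=
  (funext H : f = g) ▸ hf

theorem PartrecIn.of_partrec {f : α →. σ} (hf : Partrec f) : PartrecIn A f :=
  RecursiveIn.of_partrec hf

theorem PartrecIn.nat_iff {f : ℕ →. ℕ} : PartrecIn A f ↔ RecursiveIn A f := by
  simp [PartrecIn, Part.map_id']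

theorem ComputableIn.of_computable {f : α → σ} (hf : Computable f) : ComputableIn A f :=
  PartrecIn.of_partrec hf.partrec

theorem ComputableIn.of_eq {f g : α → σ} (hf : ComputableIn A f) (H : ∀ n, f n = g n) :
    ComputableIn A g :=
  (funext H : f = g) ▸ hf

theorem PartrecIn.comp {f : β →. σ} {g : α → β} (hf : PartrecIn A f) (hg : ComputableIn A g) :
    PartrecIn A fun a => f (g a) :=
  (RecursiveIn.comp hf hg).of_eq fun n => by
    simp only [PFun.coe_val, Part.map_some, Part.bind_eq_bind]
    rcases e : decode (α := α) n with - | a <;> simp [encodek]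

theorem ComputableIn.comp {f : β → σ} {g : α → β} (hf : ComputableIn A f)
    (hg : ComputableIn A g) : ComputableIn A fun a => f (g a) :=
  PartrecIn.comp (f := (f : β →. σ)) hf hg

theorem ComputableIn.pair {f : α → β} {g : α → γ} (hf : ComputableIn A f)
    (hg : ComputableIn A g) : ComputableIn A fun a => (f a, g a) :=
  (RecursiveIn.pair hf hg).of_eq fun n => by cases decode (α := α) n <;> simp [Seq.seq]

theorem _root_.Computable.compIn {f : β → σ} {g : α → β} (hf : Computable f)
    (hg : ComputableIn A g) : ComputableIn A fun a => f (g a) :=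
  (ComputableIn.of_computable hf).comp hg

theorem _root_.Computable₂.compIn {f : β → γ → σ} {g : α → β} {h : α → γ} (hf : Computable₂ f)
    (hg : ComputableIn A g) (hh : ComputableIn A h) : ComputableIn A fun a => f (g a) (h a) :=
  Computable.compIn hf (hg.pair hh)

theorem ComputableIn.id : ComputableIn A (fun a : α => a) := .of_computable Computable.id

theorem ComputableIn.const (s : σ) : ComputableIn A (fun _ : α => s) :=
  .of_computable (Computable.const s)

theorem ComputableIn.fst {f : α → β × γ} (hf : ComputableIn A f) :
    ComputableIn A fun a => (f a).1 :=
  Computable.fst.compIn hf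

theorem ComputableIn.snd {f : α → β × γ} (hf : ComputableIn A f) :
    ComputableIn A fun a => (f a).2 :=
  Computable.snd.compIn hf

theorem ComputableIn.comp₂ {f : β → γ → σ} {g : α → β} {h : α → γ}
    (hf : ComputableIn A fun p : β × γ => f p.1 p.2) (hg : ComputableIn A g)
    (hh : ComputableIn A h) : ComputableIn A fun a => f (g a) (h a) :=
  ComputableIn.comp (f := fun p : β × γ => f p.1 p.2) hf (hg.pair hh)

theorem ComputableIn.nat_rec {f : α → ℕ} {g : α → σ} {h : α → ℕ → σ → σ}
    (hf : ComputableIn A f) (hg : ComputableIn A g)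
    (hh : ComputableIn A fun p : α × ℕ × σ => h p.1 p.2.1 p.2.2) :
    ComputableIn A fun a => Nat.rec (motive := fun _ => σ) (g a) (fun y IH => h a y IH) (f a) := by
  have id' : RecursiveIn A (fun n => (n : Part ℕ)) := .of_partrec Nat.Partrec.some
  refine (((RecursiveIn.prec hg hh).comp (id'.pair hf))).of_eq fun n => ?_
  rcases e : decode (α := α) n with - | a
  · simp [Seq.seq]
  · simp only [Seq.seq, Part.coe_some, PFun.coe_val, Part.bind_some]
    simp [e]
    induction f a <;> simp_all [encodek]

theorem PartrecIn.rfind {p : α → ℕ → Bool} (hp : ComputableIn A fun q : α × ℕ => p q.1 q.2) :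
    PartrecIn A fun a => Nat.rfind (p a) := by
  have h : ComputableIn A fun q : α × ℕ => cond (p q.1 q.2) 0 1 :=
    (Primrec.dom_bool fun b => cond b 0 1).to_comp.compIn hp
  refine (RecursiveIn.rfind h).of_eq fun n => ?_
  rcases e : decode (α := α) n with - | a
  · simpa [e] using Nat.rfind_zero_none _ rfl
  · simp only [e, Part.coe_some, Part.bind_some, decode_prod_val, Nat.unpair_pair, encode_nat,
      decode_nat, Option.map_some, Option.bind_some, PFun.coe_val, Part.map_some]
    refine Eq.trans (congrArg Nat.rfind ?_) (Part.map_id' (fun _ => rfl) _).symm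
    funext m
    cases e' : p a m <;> simp [e']

theorem ComputableIn.find {p : α → ℕ → Bool} (hp : ComputableIn A fun q : α × ℕ => p q.1 q.2)
    (H : ∀ a, ∃ n, p a n = true) : ComputableIn A fun a => Nat.find (H a) := by
  refine (PartrecIn.rfind hp).of_eq fun a => Part.eq_some_iff.2 ?_
  simp only [PFun.coe_val, Nat.mem_rfind, Part.mem_some_iff]
  exact ⟨(Nat.find_spec (H a)).symm, fun h => by simpa using Nat.find_min (H a) h⟩

/-- `F` is a monotone total approximation, computable in `A`, of the partial function `f`. -/
structure StageApprox (A : Set ℕ) (f : ℕ →. ℕ) (F : ℕ → ℕ → Option ℕ) : Prop where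
  comp : ComputableIn A fun p : ℕ × ℕ => F p.1 p.2
  mono : ∀ {n s t y}, s ≤ t → F n s = some y → F n t = some y
  mem : ∀ {n y}, y ∈ f n ↔ ∃ s, F n s = some y

theorem StageApprox.of_computableIn {g : ℕ → ℕ} (hg : ComputableIn A g) :
    StageApprox A g fun n _ => some (g n) where
  comp := Computable.option_some.compIn (hg.comp ComputableIn.id.fst)
  mono _ h := h
  mem := by simp [eq_comm]

theorem StageApprox.pair {f g : ℕ →. ℕ} {F G : ℕ → ℕ → Option ℕ} (hf : StageApprox A f F)
    (hg : StageApprox A g G) :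
    StageApprox A (fun n => Nat.pair <$> f n <*> g n)
      fun n s => (F n s).bind fun a => (G n s).map (Nat.pair a) where
  comp := by
    have : Primrec₂ fun o₁ o₂ : Option ℕ => o₁.bind fun a => o₂.map (Nat.pair a) :=
      Primrec.option_bind Primrec.fst (Primrec.option_map (Primrec.snd.comp Primrec.fst)
        (Primrec₂.natPair.comp₂ (Primrec.snd.comp₂ Primrec₂.left) Primrec₂.right))
    exact this.to_comp.compIn hf.comp hg.comp
  mono h := by
    simp only [Option.bind_eq_some_iff, Option.map_eq_some_iff]
    rintro ⟨a, ha, b, hb, rfl⟩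
    exact ⟨a, hf.mono h ha, b, hg.mono h hb, rfl⟩
  mem := by
    intro n y
    simp only [Option.bind_eq_some_iff, Option.map_eq_some_iff, Seq.seq, Part.map_eq_map,
      Part.mem_bind_iff, Part.mem_map_iff, exists_exists_and_eq_and, hf.mem, hg.mem]
    constructor
    · rintro ⟨a, ⟨s, hs⟩, b, ⟨t, ht⟩, rfl⟩
      exact ⟨max s t, a, hf.mono (le_max_left _ _) hs, b, hg.mono (le_max_right _ _) ht, rfl⟩
    · rintro ⟨s, a, ha, b, hb, rfl⟩
      exact ⟨a, ⟨s, ha⟩, b, ⟨s, hb⟩, rfl⟩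

theorem ComputableIn.option_bind {o : α → Option β} {f : α → β → Option σ} [Inhabited β]
    (ho : ComputableIn A o) (hf : ComputableIn A fun p : α × β => f p.1 p.2) :
    ComputableIn A fun a => (o a).bind (f a) := by
  have hφ : Primrec₂ fun (o : Option β) (p : Option σ) => o.bind fun _ => p :=
    Primrec.option_bind Primrec.fst (Primrec.snd.comp₂ Primrec₂.left)
  have hd : ComputableIn A fun a => (o a).getD default :=
    (Primrec.option_getD.comp Primrec.id (Primrec.const default)).to_comp.compIn ho
  refine (hφ.to_comp.compIn ho (hf.comp (ComputableIn.id.pair hd))).of_eq fun a => ?_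
  cases o a <;> rfl

theorem StageApprox.bind {f g : ℕ →. ℕ} {F G : ℕ → ℕ → Option ℕ} (hf : StageApprox A f F)
    (hg : StageApprox A g G) :
    StageApprox A (fun n => g n >>= f) fun n s => (G n s).bind fun m => F m s where
  comp := hg.comp.option_bind (hf.comp.comp (ComputableIn.id.snd.pair ComputableIn.id.fst.snd))
  mono h := by
    simp only [Option.bind_eq_some_iff]
    rintro ⟨a, ha, hb⟩
    exact ⟨a, hg.mono h ha, hf.mono h hb⟩
  mem := by
    intro n y
    constructor
    · intro h
      obtain ⟨a, ha, hb⟩ := Part.mem_bind_iff.1 h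
      obtain ⟨s, hs⟩ := hg.mem.1 ha
      obtain ⟨t, ht⟩ := hf.mem.1 hb
      exact ⟨max s t, Option.bind_eq_some_iff.2
        ⟨a, hg.mono (le_max_left _ _) hs, hf.mono (le_max_right _ _) ht⟩⟩
    · rintro ⟨s, h⟩
      obtain ⟨a, ha, hb⟩ := Option.bind_eq_some_iff.1 h
      exact Part.mem_bind_iff.2 ⟨a, hg.mem.2 ⟨s, ha⟩, hf.mem.2 ⟨s, hb⟩⟩

/-- Primitive recursion carried out at stage `s`. -/
def precStage (F G : ℕ → ℕ → Option ℕ) (a s : ℕ) : ℕ → Option ℕ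
  | 0 => F a s
  | y + 1 => (precStage F G a s y).bind fun i => G (Nat.pair a (Nat.pair y i)) s

theorem precStage_eq_rec (F G : ℕ → ℕ → Option ℕ) (a s n : ℕ) :
    precStage F G a s n = Nat.rec (motive := fun _ => Option ℕ) (F a s)
      (fun y IH => IH.bind fun i => G (Nat.pair a (Nat.pair y i)) s) n := by
  induction n with
  | zero => rfl
  | succ n ih => simp only [precStage, ih]

theorem precStage_mono {f g : ℕ →. ℕ} {F G : ℕ → ℕ → Option ℕ} (hf : StageApprox A f F)
    (hg : StageApprox A g G) {a n s t y : ℕ} (h : s ≤ t) (hy : precStage F G a s n = some y) :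
    precStage F G a t n = some y := by
  induction n generalizing y with
  | zero => exact hf.mono h hy
  | succ n ih =>
    simp only [precStage, Option.bind_eq_some_iff] at hy ⊢
    obtain ⟨a, ha, hb⟩ := hy
    exact ⟨a, ih ha, hg.mono h hb⟩

theorem StageApprox.prec {f g : ℕ →. ℕ} {F G : ℕ → ℕ → Option ℕ} (hf : StageApprox A f F)
    (hg : StageApprox A g G) :
    StageApprox A (Nat.unpaired fun a n =>
        n.rec (f a) fun y IH => do let i ← IH; g (Nat.pair a (Nat.pair y i)))
      (fun p s => precStage F G p.unpair.1 s p.unpair.2) where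
  comp := by
    have hu : Computable fun p : ℕ × ℕ => p.1.unpair := Computable.unpair.comp Computable.fst
    have hstep : ComputableIn A fun p : (ℕ × ℕ) × ℕ × Option ℕ => p.2.2.bind fun i =>
        G (Nat.pair p.1.1.unpair.1 (Nat.pair p.2.1 i)) p.1.2 := by
      refine ComputableIn.option_bind (f := fun (p : (ℕ × ℕ) × ℕ × Option ℕ) i =>
        G (Nat.pair p.1.1.unpair.1 (Nat.pair p.2.1 i)) p.1.2) ComputableIn.id.snd.snd ?_
      refine hg.comp.comp (g := fun p : ((ℕ × ℕ) × ℕ × Option ℕ) × ℕ =>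
        (Nat.pair p.1.1.1.unpair.1 (Nat.pair p.1.2.1 p.2), p.1.1.2)) (.of_computable ?_)
      exact Computable.pair
        (Primrec₂.natPair.to_comp.comp
          (Computable.fst.comp (hu.comp (Computable.fst.comp .fst)))
          (Primrec₂.natPair.to_comp.comp (Computable.fst.comp (Computable.snd.comp .fst)) .snd))
        (Computable.snd.comp (Computable.fst.comp .fst))
    refine (ComputableIn.nat_rec (h := fun (p : ℕ × ℕ) y IH => Option.bind IH fun i =>
      G (Nat.pair p.1.unpair.1 (Nat.pair y i)) p.2)
      (.of_computable (Computable.snd.comp hu))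
      (hf.comp.comp (.pair (.of_computable (Computable.fst.comp hu)) ComputableIn.id.snd))
      hstep).of_eq fun p => (precStage_eq_rec ..).symm
  mono h := precStage_mono hf hg h
  mem {p y} := by
    simp only [Nat.unpaired]
    induction p.unpair.2 generalizing y with
    | zero => exact hf.mem
    | succ n ih =>
      constructor
      · intro h
        obtain ⟨a, ha, hb⟩ := Part.mem_bind_iff.1 h
        obtain ⟨s, hs⟩ := ih.1 ha
        obtain ⟨t, ht⟩ := hg.mem.1 hb
        exact ⟨max s t, Option.bind_eq_some_iff.2
          ⟨a, precStage_mono hf hg (le_max_left _ _) hs, hg.mono (le_max_right _ _) ht⟩⟩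
      · rintro ⟨s, h⟩
        obtain ⟨a, ha, hb⟩ := Option.bind_eq_some_iff.1 h
        exact Part.mem_bind_iff.2 ⟨a, ih.2 ⟨s, ha⟩, hg.mem.2 ⟨s, hb⟩⟩

/-- Bounded search for a zero of `v`: `none` means that an undefined value has been met,
and `some (some y)` that the least zero is `y`. -/
def searchStage (v : ℕ → Option ℕ) : ℕ → Option (Option ℕ)
  | 0 => some none
  | y + 1 => (searchStage v y).bind fun o =>
      o.elim ((v y).map fun k => if k = 0 then some y else none) fun z => some (some z)

theorem searchStage_eq_rec (v : ℕ → Option ℕ) (n : ℕ) :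
    searchStage v n = Nat.rec (motive := fun _ => Option (Option ℕ)) (some none)
      (fun y IH => IH.bind fun o =>
        o.elim ((v y).map fun k => if k = 0 then some y else none) fun z => some (some z)) n := by
  induction n with
  | zero => rfl
  | succ n ih => simp only [searchStage, ih]

theorem searchStage_eq_none_iff (v : ℕ → Option ℕ) (n : ℕ) :
    searchStage v n = some none ↔ ∀ m < n, ∃ k, v m = some (k + 1) := by
  induction n with
  | zero => simp [searchStage]
  | succ n ih =>
    rw [Nat.forall_lt_succ_right, ← ih, searchStage]
    rcases searchStage v n with - | - | z
    · simp
    · rcases v n with - | - | k <;> simp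
    · simp

theorem searchStage_eq_some_iff (v : ℕ → Option ℕ) (n y : ℕ) :
    searchStage v n = some (some y) ↔
      y < n ∧ v y = some 0 ∧ ∀ m < y, ∃ k, v m = some (k + 1) := by
  induction n with
  | zero => simp [searchStage]
  | succ n ih =>
    have hn := searchStage_eq_none_iff v n
    rw [searchStage]
    rcases e : searchStage v n with - | - | z
    · rw [e] at hn ih
      simp only [Option.bind_none, reduceCtorEq, false_iff, not_and] at hn ih ⊢
      intro hy h0 h1
      rcases Nat.lt_succ_iff_lt_or_eq.1 hy with hy | rfl
      · exact ih hy h0 h1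
      · exact hn h1
    · rw [e] at hn ih
      simp only [true_iff] at hn
      have : v n = none ∨ v n = some 0 ∨ ∃ k, v n = some (k + 1) := by
        rcases v n with - | - | k <;> simp
      have key : y < n → v y ≠ some 0 := fun hy h => by
        obtain ⟨k, hk⟩ := hn y hy
        simp [hk] at h
      simp only [Option.bind_some, Option.elim_none]
      constructor
      · intro h
        rcases this with h' | h' | ⟨k, h'⟩ <;> simp [h'] at h
        subst h
        exact ⟨Nat.lt_succ_self _, h', hn⟩
      · rintro ⟨hy, h0, h1⟩
        rcases Nat.lt_succ_iff_lt_or_eq.1 hy with hy | rfl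
        · exact absurd h0 (key hy)
        · simp [h0]
    · rw [e] at hn ih
      simp only [Option.bind_some, Option.elim_some]
      refine ih.trans ⟨fun h => ⟨h.1.trans (Nat.lt_succ_self _), h.2⟩, fun ⟨hy, h⟩ => ?_⟩
      refine ⟨(Nat.lt_succ_iff_lt_or_eq.1 hy).resolve_right ?_, h⟩
      rintro rfl
      simpa using hn.2 h.2

/-- One step of the recursion defining `searchStage`. -/
def searchStep (p : Option (Option ℕ) × ℕ) (w : Option ℕ) : Option (Option ℕ) :=
  p.1.bind fun o => o.elim (w.map fun k => if k = 0 then some p.2 else none) fun z => some (some z)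

theorem primrec₂_searchStep : Primrec₂ searchStep := by
  have hw : Primrec fun q : (Option (Option ℕ) × ℕ) × Option ℕ =>
      q.2.map fun k => if k = 0 then some q.1.2 else none :=
    Primrec.option_map Primrec.snd (Primrec.ite
      (Primrec.eq.comp Primrec.snd (Primrec.const 0))
      (Primrec.option_some.comp (Primrec.snd.comp (Primrec.fst.comp Primrec.fst)))
      (Primrec.const none))
  refine Primrec.option_bind (Primrec.fst.comp Primrec.fst) ?_
  refine (Primrec.option_casesOn (o := fun q : ((Option (Option ℕ) × ℕ) × Option ℕ) ×
    Option ℕ => q.2) Primrec.snd (hw.comp Primrec.fst)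
    (Primrec.option_some.comp (Primrec.option_some.comp Primrec.snd)).to₂).of_eq ?_
  rintro ⟨_, _ | _⟩ <;> rfl

theorem computableIn_searchStage {F : ℕ → ℕ → Option ℕ}
    (hF : ComputableIn A fun p : ℕ × ℕ => F p.1 p.2) :
    ComputableIn A fun p : ℕ × ℕ => (searchStage (fun y => F (Nat.pair p.1 y) p.2) p.2).join := by
  have hkey : Primrec fun q : (ℕ × ℕ) × ℕ × Option (Option ℕ) => Nat.pair q.1.1 q.2.1 :=
    Primrec₂.natPair.comp (Primrec.fst.comp Primrec.fst) (Primrec.fst.comp Primrec.snd)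
  have hval : ComputableIn A fun q : (ℕ × ℕ) × ℕ × Option (Option ℕ) =>
      F (Nat.pair q.1.1 q.2.1) q.1.2 :=
    hF.comp₂ (.of_computable hkey.to_comp) ComputableIn.id.fst.snd
  have hstate : ComputableIn A fun q : (ℕ × ℕ) × ℕ × Option (Option ℕ) => (q.2.2, q.2.1) :=
    .of_computable ((Primrec.snd.comp Primrec.snd).pair (Primrec.fst.comp Primrec.snd)).to_comp
  have hstep : ComputableIn A fun q : (ℕ × ℕ) × ℕ × Option (Option ℕ) =>
      searchStep (q.2.2, q.2.1) (F (Nat.pair q.1.1 q.2.1) q.1.2) :=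
    primrec₂_searchStep.to_comp.compIn hstate hval
  have hjoin : Primrec fun o : Option (Option ℕ) => o.join :=
    (Primrec.option_bind Primrec.id Primrec₂.right).of_eq fun o => by cases o <;> rfl
  have hrec := ComputableIn.nat_rec (A := A)
    (h := fun (p : ℕ × ℕ) y IH => searchStep (IH, y) (F (Nat.pair p.1 y) p.2))
    ComputableIn.id.snd (.const (some none)) hstep
  have hsearch : ComputableIn A fun p : ℕ × ℕ =>
      searchStage (fun y => F (Nat.pair p.1 y) p.2) p.2 :=
    hrec.of_eq fun p => (searchStage_eq_rec ..).symm
  exact hjoin.to_comp.compIn hsearch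

theorem StageApprox.rfind {f : ℕ →. ℕ} {F : ℕ → ℕ → Option ℕ} (hf : StageApprox A f F) :
    StageApprox A (fun a => Nat.rfind fun n => (fun m => m = 0) <$> f (Nat.pair a n))
      fun a s => (searchStage (fun y => F (Nat.pair a y) s) s).join where
  comp := computableIn_searchStage hf.comp
  mono {a s t y} h := by
    simp only [Option.join_eq_some_iff, searchStage_eq_some_iff]
    rintro ⟨hy, h0, h1⟩
    exact ⟨hy.trans_le h, hf.mono h h0, fun m hm => (h1 m hm).imp fun k hk => hf.mono h hk⟩
  mem {a y} := by
    simp only [Option.join_eq_some_iff, searchStage_eq_some_iff]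
    have hv {m : ℕ} {b : Bool} : b ∈ (fun m : ℕ => decide (m = 0)) <$> f (Nat.pair a m) ↔
        ∃ s k, F (Nat.pair a m) s = some k ∧ decide (k = 0) = b := by
      refine (Part.mem_map_iff _).trans ?_
      simp only [hf.mem]
      exact ⟨fun ⟨k, ⟨s, hs⟩, h⟩ => ⟨s, k, hs, h⟩, fun ⟨s, k, hs, h⟩ => ⟨k, ⟨s, hs⟩, h⟩⟩
    refine Nat.mem_rfind.trans ⟨fun ⟨h0, h1⟩ => ?_, fun ⟨s, _, h0, h1⟩ => ⟨?_, fun {m} hm => ?_⟩⟩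
    · obtain ⟨s, k, hs, hk⟩ := hv.1 h0
      obtain rfl : k = 0 := by simpa using hk
      have h2 : ∀ m < y, ∃ s k, F (Nat.pair a m) s = some (k + 1) := fun m hm => by
        obtain ⟨s, k, hs, hk⟩ := hv.1 (h1 hm)
        obtain ⟨k, rfl⟩ := Nat.exists_eq_succ_of_ne_zero (by simpa using hk)
        exact ⟨s, k, hs⟩
      choose! t ht using h2
      refine ⟨max s ((Finset.range (y + 1)).sup fun m => max m (t m)) + 1, ?_, ?_, ?_⟩
      · have : max y (t y) ≤ (Finset.range (y + 1)).sup fun m => max m (t m) :=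
          Finset.le_sup (f := fun m => max m (t m)) (Finset.self_mem_range_succ y)
        omega
      · exact hf.mono (by omega) hs
      · intro m hm
        have : max m (t m) ≤ (Finset.range (y + 1)).sup fun m => max m (t m) :=
          Finset.le_sup (f := fun m => max m (t m)) (Finset.mem_range.2 (by omega))
        exact (ht m hm).imp fun k hk => hf.mono (by omega) hk
    · exact hv.2 ⟨s, 0, h0, by simp⟩
    · obtain ⟨k, hk⟩ := h1 m hm
      exact hv.2 ⟨s, k + 1, hk, by simp⟩

theorem RecursiveIn.exists_stageApprox {f : ℕ →. ℕ} (hf : RecursiveIn A f) :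
    ∃ F, StageApprox A f F := by
  have total {g : ℕ → ℕ} (hg : RecursiveIn A g) : ∃ F, StageApprox A g F :=
    ⟨_, .of_computableIn (PartrecIn.nat_iff.2 hg)⟩
  induction hf with
  | zero => exact total .zero
  | succ => exact total .succ
  | left => exact total .left
  | right => exact total .right
  | oracle =>
    have h : (fun n => A.indicator (fun _ => 1) n : ℕ →. ℕ) =
        ((A.indicator fun _ => 1 : ℕ → ℕ) : ℕ →. ℕ) := by
      funext n
      by_cases hn : n ∈ A <;> simp [hn] <;> rfl
    rw [h]
    exact total (h ▸ RecursiveIn.oracle)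
  | pair _ _ ih₁ ih₂ =>
    obtain ⟨F, hF⟩ := ih₁
    obtain ⟨G, hG⟩ := ih₂
    exact ⟨_, hF.pair hG⟩
  | comp _ _ ih₁ ih₂ =>
    obtain ⟨F, hF⟩ := ih₁
    obtain ⟨G, hG⟩ := ih₂
    exact ⟨_, hF.bind hG⟩
  | prec _ _ ih₁ ih₂ =>
    obtain ⟨F, hF⟩ := ih₁
    obtain ⟨G, hG⟩ := ih₂
    exact ⟨_, hF.prec hG⟩
  | rfind _ ih =>
    obtain ⟨F, hF⟩ := ih
    exact ⟨_, hF.rfind⟩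

theorem cyl_eq_cylinder (σ : List Bool) :
    Cyl σ = PiNat.cylinder (fun i => σ.getD i false) σ.length := rfl

theorem isOpen_cyl (σ : List Bool) : IsOpen (Cyl σ) := by
  rw [cyl_eq_cylinder]
  exact PiNat.isOpen_cylinder _ _ _

theorem getD_mem_cyl (σ τ : List Bool) : (fun i => (σ ++ τ).getD i false) ∈ Cyl σ := fun i hi => by
  simp [List.getElem?_append_left hi]

theorem mem_cyl_map_range {x y : ℕ → Bool} {n : ℕ} :
    y ∈ Cyl ((List.range n).map x) ↔ ∀ i < n, y i = x i := by
  simp +contextual [Cyl]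

theorem cylinder_eq_cyl (x : ℕ → Bool) (n : ℕ) :
    PiNat.cylinder x n = Cyl ((List.range n).map x) := by
  ext y
  simp [mem_cyl_map_range, PiNat.cylinder]

theorem isNowhereDense_compl_iUnion_cyl (W : Set (List Bool)) :
    IsNowhereDense (⋃ σ ∈ W, Cyl σ)ᶜ ↔ ∀ σ, ∃ τ ∈ W, (Cyl σ ∩ Cyl τ).Nonempty := by
  have hO : IsOpen (⋃ σ ∈ W, Cyl σ) := isOpen_biUnion fun σ _ => isOpen_cyl σ
  have h := isClosed_isNowhereDense_iff_compl (s := (⋃ σ ∈ W, Cyl σ)ᶜ)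
  rw [compl_compl, and_iff_right hO, and_iff_right hO.isClosed_compl] at h
  rw [h, (PiNat.isTopologicalBasis_cylinders fun _ : ℕ => Bool).dense_iff]
  constructor
  · intro H σ
    obtain ⟨x, hx, hW⟩ := H (Cyl σ) ⟨_, _, cyl_eq_cylinder σ⟩ ⟨_, getD_mem_cyl σ []⟩
    obtain ⟨τ, hτ, hxτ⟩ := Set.mem_iUnion₂.1 hW
    exact ⟨τ, hτ, x, hx, hxτ⟩
  · rintro H _ ⟨x, n, rfl⟩ -
    obtain ⟨τ, hτ, y, hy, hyτ⟩ := H ((List.range n).map x)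
    exact ⟨y, cylinder_eq_cyl x n ▸ hy, Set.mem_iUnion₂.2 ⟨τ, hτ, hyτ⟩⟩

/-- The string `0ᵏ1`. -/
def unaryBlock (k : ℕ) : List Bool := List.replicate k false ++ [true]

theorem primrec_unaryBlock : Primrec unaryBlock :=
  (Primrec.list_concat.comp (Primrec.list_map Primrec.list_range (Primrec.const false).to₂)
    (Primrec.const true)).of_eq fun k => by simp [unaryBlock, List.map_const']

/-- For `q = ((m, σ), n)`: the string `σ` ends with the block `0ᵏ1` at position `n ≥ m`. -/
def endsWithBlock (q : (ℕ × List Bool) × ℕ) (k : ℕ) : Bool :=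
  decide (q.1.1 ≤ q.2 ∧ q.1.2.drop q.2 = unaryBlock k)

theorem primrec₂_endsWithBlock : Primrec₂ endsWithBlock :=
  ((Primrec.nat_le.comp (Primrec.fst.comp (Primrec.fst.comp Primrec.fst))
    (Primrec.snd.comp Primrec.fst)).and (Primrec.eq.comp
      (Primrec.list_drop.comp (Primrec.snd.comp Primrec.fst)
        (Primrec.snd.comp (Primrec.fst.comp Primrec.fst)))
      (primrec_unaryBlock.comp Primrec.snd))).decide

theorem WeaklyMeagerEngulfing.of_eventually_ne {f : ℕ → ℕ} (hf : ComputableIn A f)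
    (H : ∀ h : ℕ → ℕ, Computable h → ∀ᶠ n in atTop, f n ≠ h n) : WeaklyMeagerEngulfing A := by
  let W : Set (ℕ × List Bool) := {q | ∃ n, q.1 ≤ n ∧ q.2.drop n = unaryBlock (f n)}
  let C : ℕ → Set (ℕ → Bool) := fun m => (⋃ σ ∈ {s | (m, s) ∈ W}, Cyl σ)ᶜ
  refine ⟨⋃ m, C m, ⟨C, ⟨W, ?_, fun m => rfl⟩, fun m => ?_, subset_rfl⟩, fun x hx => ?_⟩
  · have hp : ComputableIn A fun q : (ℕ × List Bool) × ℕ => endsWithBlock q (f q.2) :=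
      primrec₂_endsWithBlock.to_comp.compIn ComputableIn.id (hf.comp ComputableIn.id.snd)
    refine ⟨_, PartrecIn.rfind (p := fun q n => endsWithBlock (q, n) (f n)) hp, fun q => ?_⟩
    simp [W, Nat.rfind_dom, endsWithBlock]
  · refine (isNowhereDense_compl_iUnion_cyl _).2 fun σ => ?_
    let n := max m σ.length
    let τ := List.replicate (n - σ.length) false ++ unaryBlock (f n)
    refine ⟨σ ++ τ, ⟨n, le_max_left _ _, ?_⟩, _, getD_mem_cyl σ τ,
      by simpa using getD_mem_cyl (σ ++ τ) []⟩
    have hn : σ.length ≤ n := le_max_right _ _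
    simp [τ, List.drop_append, hn]
  · have key {m : ℕ} (hm : x ∉ C m) :
        ∃ n ≥ m, x (n + f n) = true ∧ ∀ k < f n, x (n + k) = false := by
      obtain ⟨σ, ⟨n, hmn, hσ⟩, hxσ⟩ := Set.mem_iUnion₂.1 (not_not.1 hm)
      have hlen : σ.length = n + (f n + 1) := by
        have := congrArg List.length hσ
        simp [unaryBlock] at this
        omega
      have hget (k : ℕ) (hk : k ≤ f n) : x (n + k) = (unaryBlock (f n)).getD k false := by
        rw [hxσ _ (by omega), ← hσ]
        simp
      refine ⟨n, hmn, by simp [hget, unaryBlock], fun k hk => ?_⟩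
      simp [hget k hk.le, unaryBlock, List.getElem?_append, hk]
    by_cases hinf : ∀ n, ∃ k, x (n + k) = true
    · have hp : Computable₂ fun n k => x (n + k) := hx.comp Primrec.nat_add.to_comp
      have hh : Computable fun n => Nat.find (hinf n) := by
        refine (Partrec.rfind hp.partrec₂).of_eq fun n => Part.eq_some_iff.2 ?_
        simp only [PFun.coe_val, Nat.mem_rfind, Part.mem_some_iff]
        exact ⟨(Nat.find_spec (hinf n)).symm, fun h => by simpa using Nat.find_min (hinf n) h⟩
      obtain ⟨m, hm⟩ := eventually_atTop.1 (H _ hh)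
      refine Set.mem_iUnion.2 ⟨m, by_contra fun hx => ?_⟩
      obtain ⟨n, hn, h1, h2⟩ := key hx
      exact hm n hn ((Nat.find_eq_iff (hinf n)).2 ⟨h1, fun k hk => by simp [h2 k hk]⟩).symm
    · push Not at hinf
      obtain ⟨m, hm⟩ := hinf
      refine Set.mem_iUnion.2 ⟨m, by_contra fun hx => ?_⟩
      obtain ⟨n, hn, h1, -⟩ := key hx
      exact hm (n - m + f n) (by rwa [← add_assoc, Nat.add_sub_cancel' hn])

theorem ComputableIn.exists_choice [Inhabited β] {t : α → β → Bool}
    (ht : ComputableIn A fun p : α × β => t p.1 p.2) (H : ∀ a, ∃ b, t a b = true) :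
    ∃ c : α → β, ComputableIn A c ∧ ∀ a, t a (c a) = true := by
  have hd : Computable fun n : ℕ => (decode (α := β) n).getD default :=
    (Primrec.option_getD.comp Primrec.decode (Primrec.const default)).to_comp
  have H' (a : α) : ∃ n, t a ((decode (α := β) n).getD default) = true :=
    (H a).imp' encode fun b hb => by simpa using hb
  have hs : ComputableIn A fun q : α × ℕ => t q.1 ((decode (α := β) q.2).getD default) :=
    ht.comp₂ ComputableIn.id.fst (hd.compIn ComputableIn.id.snd)
  exact ⟨_, hd.compIn (ComputableIn.find hs H'), fun a => Nat.find_spec (H' a)⟩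

theorem ComputableIn.nat_rec_const {s : σ} {h : ℕ → σ → σ}
    (hh : ComputableIn A fun p : ℕ × σ => h p.1 p.2) :
    ComputableIn A fun n => Nat.rec (motive := fun _ => σ) s h n :=
  ComputableIn.nat_rec (f := fun n : ℕ => n) (h := fun _ => h) ComputableIn.id (.const s)
    (hh.comp ComputableIn.id.snd)

theorem mem_cyl_append_left {x : ℕ → Bool} {σ τ : List Bool} (h : x ∈ Cyl (σ ++ τ)) :
    x ∈ Cyl σ := fun i hi => by
  rw [h i (by simp; omega), List.getD_append _ _ _ _ hi]

theorem mem_cyl_of_prefix {x : ℕ → Bool} {σ τ : List Bool} (h : x ∈ Cyl τ) (hp : σ <+: τ) :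
    x ∈ Cyl σ := by
  obtain ⟨ρ, rfl⟩ := hp
  exact mem_cyl_append_left h

theorem natPair_le_natPair {a b c d : ℕ} (h₁ : a ≤ b) (h₂ : c ≤ d) :
    Nat.pair a c ≤ Nat.pair b d :=
  ((StrictMono.monotone fun _ _ => Nat.pair_lt_pair_left c) h₁).trans
    ((StrictMono.monotone fun _ _ => Nat.pair_lt_pair_right b) h₂)

/-- Upper bound for the codes of binary strings of length at most `k`. -/
def stringCodeBound (k : ℕ) : ℕ := Nat.rec 0 (fun _ b => (Nat.pair 1 b).succ) k

theorem encode_le_stringCodeBound {σ : List Bool} {k : ℕ} (h : σ.length ≤ k) :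
    encode σ ≤ stringCodeBound k := by
  induction k generalizing σ with
  | zero => simp [List.length_eq_zero_iff.1 (Nat.le_zero.1 h), stringCodeBound]
  | succ k ih =>
    rcases σ with - | ⟨b, σ⟩
    · simp
    · rw [encode_list_cons]
      refine Nat.succ_le_succ (natPair_le_natPair ?_ (ih (by simpa using h)))
      cases b <;> simp

theorem primrec_stringCodeBound : Primrec stringCodeBound :=
  Primrec.nat_rec₁ _ (Primrec.succ.comp₂
    (Primrec₂.natPair.comp₂ (Primrec.const 1).to₂ Primrec₂.right))

theorem stringCodeBound_mono : Monotone stringCodeBound :=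
  monotone_nat_of_le_succ fun _ => (Nat.right_le_pair _ _).trans (Nat.le_succ _)

/-- Computably in `A`, a single string `y k` pushes all strings of length at most `k` outside of
the first `k` nowhere dense classes. -/
theorem UnifPi01In.exists_escape {C : ℕ → Set (ℕ → Bool)} (hC : UnifPi01In A C)
    (hnd : ∀ m, IsNowhereDense (C m)) :
    ∃ y : ℕ → List Bool, ComputableIn A y ∧ Monotone (fun k => (y k).length) ∧
      ∀ k m σ, m ≤ k → σ.length ≤ k → ∀ x ∈ Cyl (σ ++ y k), x ∉ C m := by
  obtain ⟨W, ⟨ψ, hψ, hW⟩, hC⟩ := hC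
  obtain ⟨F, hF⟩ := hψ.exists_stageApprox
  have hWF (q : ℕ × List Bool) : q ∈ W ↔ ∃ s, (F (encode q) s).isSome = true := by
    rw [hW, Part.dom_iff_mem]
    simp only [Option.isSome_iff_exists]
    rw [exists_comm]
    refine exists_congr fun v => ?_
    rw [← hF.mem]
    simp
  obtain ⟨c, hc, hcF⟩ := ComputableIn.exists_choice (A := A)
    (t := fun (q : ℕ × List Bool) (d : List Bool × ℕ × ℕ) =>
      (F (encode (q.1, (q.2 ++ d.1).take d.2.1)) d.2.2).isSome) (by
      have h1 : Primrec fun p : (ℕ × List Bool) × List Bool × ℕ × ℕ =>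
          encode (p.1.1, (p.1.2 ++ p.2.1).take p.2.2.1) :=
        Primrec.encode.comp ((Primrec.fst.comp Primrec.fst).pair (Primrec.list_take.comp
          (Primrec.fst.comp (Primrec.snd.comp Primrec.snd)) (Primrec.list_append.comp
            (Primrec.snd.comp Primrec.fst) (Primrec.fst.comp Primrec.snd))))
      exact Primrec.option_isSome.to_comp.compIn
        (hF.comp.comp₂ (.of_computable h1.to_comp) ComputableIn.id.snd.snd.snd)) (by
      rintro ⟨m, σ⟩
      obtain ⟨τ, hτ, x, hxσ, hxτ⟩ := (isNowhereDense_compl_iUnion_cyl _).1 (hC m ▸ hnd m) σ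
      obtain ⟨s, hs⟩ := (hWF _).1 hτ
      by_cases hle : τ.length ≤ σ.length
      · refine ⟨([], τ.length, s), ?_⟩
        have : σ.take τ.length = τ := List.ext_getElem (by simpa using hle) fun i h1 h2 => by
          have h3 := hxσ i (by omega)
          have h4 := hxτ i h2
          simp [h2, h2.trans_le hle] at h3 h4 ⊢
          rw [← h3, h4]
        simpa [this] using hs
      · refine ⟨(τ.drop σ.length, τ.length, s), ?_⟩
        have : σ ++ τ.drop σ.length = τ := List.ext_getElem (by simp; omega) fun i h1 h2 => by
          rw [List.getElem_append]
          split_ifs with h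
          · have h3 := hxσ i h
            have h4 := hxτ i h2
            simp [h2, h] at h3 h4 ⊢
            rw [← h3, h4]
          · simp [Nat.add_sub_cancel' (not_lt.1 h)]
        simpa [this] using hs)
  let step (n : ℕ) (τ : List Bool) : List Bool :=
    τ ++ (c (((decode (α := ℕ × List Bool) n).getD default).1,
      ((decode (α := ℕ × List Bool) n).getD default).2 ++ τ)).1
  let T (n : ℕ) : List Bool := Nat.rec [] step n
  have hT : ComputableIn A T := by
    have hd : Primrec fun p : ℕ × List Bool => (decode (α := ℕ × List Bool) p.1).getD default :=
      Primrec.option_getD.comp (Primrec.decode.comp Primrec.fst) (Primrec.const default)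
    have hq : Primrec fun p : ℕ × List Bool =>
        (((decode (α := ℕ × List Bool) p.1).getD default).1,
          ((decode (α := ℕ × List Bool) p.1).getD default).2 ++ p.2) :=
      (Primrec.fst.comp hd).pair (Primrec.list_append.comp (Primrec.snd.comp hd) Primrec.snd)
    exact ComputableIn.nat_rec_const (Primrec.list_append.to_comp.compIn ComputableIn.id.snd
      (hc.comp (.of_computable hq.to_comp)).fst)
  have hTsucc (n : ℕ) : T n <+: T (n + 1) := List.prefix_append _ _
  have hTmono {a b : ℕ} (h : a ≤ b) : T a <+: T b := by
    induction h with
    | refl => exact List.prefix_rfl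
    | step _ ih => exact ih.trans (hTsucc _)
  let B (k : ℕ) : ℕ := Nat.pair k (stringCodeBound k) + 1
  have hB : Primrec B :=
    Primrec.succ.comp (Primrec₂.natPair.comp Primrec.id primrec_stringCodeBound)
  refine ⟨fun k => T (B k), hT.comp (.of_computable hB.to_comp), fun k l hkl => ?_, ?_⟩
  · exact (hTmono (Nat.succ_le_succ (natPair_le_natPair hkl (stringCodeBound_mono hkl)))).length_le
  · intro k m σ hm hσ x hx
    rw [hC, Set.notMem_compl_iff]
    have hlt : encode (m, σ) + 1 ≤ B k :=
      Nat.succ_le_succ (natPair_le_natPair hm (encode_le_stringCodeBound hσ))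
    have hx' : x ∈ Cyl (σ ++ T (encode (m, σ) + 1)) :=
      mem_cyl_of_prefix hx ((List.prefix_append_right_inj σ).2 (hTmono hlt))
    have hW' := (hWF _).2 ⟨_, hcF (m, σ ++ T (encode (m, σ)))⟩
    refine Set.mem_iUnion₂.2 ⟨_, hW', mem_cyl_of_prefix hx' ?_⟩
    refine (List.take_prefix _ _).trans ?_
    simp only [T, step, encodek, Option.getD_some, List.append_assoc]
    exact List.prefix_rfl

/-- Every function computable in `A` agrees infinitely often with some computable function. -/
def InfinitelyOftenComputable (A : Set ℕ) : Prop :=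
  ∀ f : ℕ → ℕ, ComputableIn A f → ∃ h : ℕ → ℕ, Computable h ∧ ∃ᶠ n in atTop, f n = h n

theorem InfinitelyOftenComputable.exists_frequently_le_succ (H : InfinitelyOftenComputable A)
    {p : ℕ → ℕ} (hp : ComputableIn A p) (hmono : Monotone p) (hlt : ∀ k, k < p k) :
    ∃ g : ℕ → ℕ, Computable g ∧ StrictMono g ∧ ∃ᶠ n in atTop, p (g n) ≤ g (n + 1) := by
  have hrec (a k : ℕ) : Nat.rec (motive := fun _ => ℕ) a (fun _ => p) k = p^[k] a := by
    induction k with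
    | zero => rfl
    | succ k ih => rw [Function.iterate_succ_apply', ← ih]
  have hq : ComputableIn A fun n => p^[n] n :=
    (ComputableIn.nat_rec (f := fun n : ℕ => n) (g := fun n => n) (h := fun _ _ => p)
      ComputableIn.id ComputableIn.id (hp.comp ComputableIn.id.snd.snd)).of_eq fun n => hrec n n
  obtain ⟨h, hh, hfreq⟩ := H _ hq
  let g (n : ℕ) : ℕ := Nat.rec (h 0 + 1) (fun n v => v + (h (n + 1) + 1)) n
  have hg : Computable g :=
    Computable.nat_rec (f := fun n : ℕ => n) (h := fun (_ : ℕ) q => q.2 + (h (q.1 + 1) + 1))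
      Computable.id (Computable.const _)
      (Primrec.nat_add.to_comp.comp (Computable.snd.comp .snd)
        (Computable.succ.comp (hh.comp (Computable.succ.comp (Computable.fst.comp .snd)))))
  have hgh (n : ℕ) : h n < g n := by
    cases n with
    | zero => exact Nat.lt_succ_self _
    | succ n => exact (Nat.lt_succ_self _).trans_le (Nat.le_add_left _ _)
  refine ⟨g, hg, strictMono_nat_of_lt_succ fun n => Nat.lt_add_of_pos_right (Nat.succ_pos _), ?_⟩
  intro hev
  obtain ⟨N, hN⟩ := eventually_atTop.1 hev
  have hiter (j : ℕ) : g (N + j) ≤ p^[j] (g N) := by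
    induction j with
    | zero => exact le_rfl
    | succ j ih =>
      rw [Function.iterate_succ_apply']
      exact (not_le.1 (hN (N + j) (Nat.le_add_right _ _))).le.trans (hmono ih)
  obtain ⟨n, hn, hqn⟩ := frequently_atTop.1 hfreq (N + g N)
  have h1 : g n ≤ p^[n - N] (g N) := by simpa [show N + (n - N) = n by omega] using hiter (n - N)
  have h2 : p^[n - N] (g N) ≤ p^[n - N] n := hmono.iterate _ (by omega)
  have h3 : p^[n - N] n ≤ p^[n] n := hmono.monotone_iterate_of_le_map (hlt n).le (Nat.sub_le _ _)
  have h4 := hgh n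
  omega

theorem computable_two_pow : Computable fun n : ℕ => 2 ^ n :=
  (Primrec.nat_rec₁ (f := fun _ v => 2 * v) 1 (Primrec.nat_double.comp₂ Primrec₂.right)).to_comp
    |>.of_eq fun n => by
      induction n with
      | zero => rfl
      | succ n ih => rw [pow_succ', ← ih]

theorem InfinitelyOftenComputable.exists_frequently_eq [Inhabited σ]
    (H : InfinitelyOftenComputable A) {r : ℕ → Bool} (hr : ComputableIn A r)
    (hfreq : ∃ᶠ n in atTop, r n = true) {Y : ℕ → σ} (hY : ComputableIn A Y) :
    ∃ G : ℕ → σ, Computable G ∧ ∃ᶠ n in atTop, r n = true ∧ G n = Y n := by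
  obtain ⟨next, hnext, hnext_spec⟩ := ComputableIn.exists_choice (A := A)
    (t := fun a b => r b && decide (a ≤ b))
    (Primrec.and.to_comp.compIn (hr.comp ComputableIn.id.snd)
      (.of_computable (Primrec.nat_le.comp Primrec.fst Primrec.snd).decide.to_comp))
    fun a => (frequently_atTop.1 hfreq a).imp fun b hb => by simp [hb.1, hb.2]
  simp only [Bool.and_eq_true, decide_eq_true_eq] at hnext_spec
  let e (i : ℕ) : ℕ := Nat.rec (next 0) (fun _ v => next (v + 1)) i
  have he : ComputableIn A e := ComputableIn.nat_rec_const (h := fun _ v => next (v + 1))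
    (hnext.comp (Computable.succ.compIn ComputableIn.id.snd))
  have her (i : ℕ) : r (e i) = true := by cases i <;> exact (hnext_spec _).1
  have hemono : StrictMono e := strictMono_nat_of_lt_succ fun n => (hnext_spec _).2
  let L (j : ℕ) : List (ℕ × σ) :=
    (((List.range (2 ^ j + j)).map e).drop j).map fun n => (n, Y n)
  have hL : ComputableIn A L := by
    have hZ : ComputableIn A fun n => (List.range n).map fun i => (e i, Y (e i)) := by
      refine (ComputableIn.nat_rec_const (s := []) (h := fun i l => l ++ [(e i, Y (e i))])
        (Primrec.list_concat.to_comp.compIn ComputableIn.id.snd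
          ((he.pair (hY.comp he)).comp ComputableIn.id.fst))).of_eq fun n => ?_
      induction n with
      | zero => rfl
      | succ n ih => simp [List.range_succ, ← ih]
    have hlen : Computable fun j => 2 ^ j + j :=
      Primrec.nat_add.to_comp.comp computable_two_pow Computable.id
    exact (Primrec.list_drop.to_comp.compIn ComputableIn.id
      (hZ.comp (.of_computable hlen))).of_eq fun j => by
        simp [L, List.map_drop, Function.comp_def]
  obtain ⟨h, hh, hhfreq⟩ := H _ (Computable.encode.compIn hL)
  let D (j : ℕ) : List (ℕ × σ) := ((decode (h j)).getD []).take (2 ^ j)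
  have hD : Computable D :=
    Primrec.list_take.to_comp.comp computable_two_pow
      ((Primrec.option_getD.comp Primrec.decode (Primrec.const [])).to_comp.comp hh)
  let K (j : ℕ) : List (ℕ × σ) := Nat.rec [] (fun i l => l ++ D i) j
  have hK : Computable K :=
    Computable.nat_rec (f := fun n : ℕ => n) (h := fun (_ : ℕ) q => q.2 ++ D q.1)
      Computable.id (Computable.const _)
      (Primrec.list_append.to_comp.comp (Computable.snd.comp .snd)
        (hD.comp (Computable.fst.comp .snd)))
  have hKlen (j : ℕ) : (K j).length < 2 ^ j := by
    induction j with
    | zero => exact Nat.one_pos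
    | succ j ih =>
      have : (K (j + 1)).length = (K j).length + (D j).length := List.length_append
      have : (D j).length ≤ 2 ^ j := List.length_take_le _ _
      rw [pow_succ]
      omega
  have hKmono {a b : ℕ} (hab : a ≤ b) : K a <+: K b := by
    induction hab with
    | refl => exact List.prefix_rfl
    | step _ ih => exact ih.trans (List.prefix_append _ _)
  refine ⟨fun n => ((K (n + 1)).lookup n).getD default, ?_, frequently_atTop.2 fun N => ?_⟩
  · exact (Primrec.option_getD.comp Primrec.id (Primrec.const default)).to_comp.comp
      (Primrec.listLookup.to_comp.comp Computable.id (hK.comp Computable.succ))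
  · obtain ⟨j, hj, hjeq⟩ := frequently_atTop.1 hhfreq N
    have hDj : D j = L j := by
      simp only [D, ← hjeq, encodek, Option.getD_some]
      exact List.take_of_length_le (by simp [L])
    obtain ⟨n, hn, hnK⟩ := Finset.exists_mem_notMem_of_card_lt_card
      (s := ((K j).map Prod.fst).toFinset)
      (t := (Finset.range (2 ^ j)).image fun i => e (j + i)) (by
        rw [Finset.card_image_of_injective _ fun a b hab =>
          Nat.add_left_cancel (hemono.injective hab), Finset.card_range]
        exact (List.toFinset_card_le _).trans_lt (by simpa using hKlen j))
    obtain ⟨i, hi, rfl⟩ := Finset.mem_image.1 hn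
    have hji : j ≤ e (j + i) := (Nat.le_add_right j i).trans hemono.le_apply
    refine ⟨e (j + i), hj.trans hji, her _, ?_⟩
    obtain ⟨R, hR⟩ := hKmono (Nat.succ_le_succ hji)
    have hnone : (K j).lookup (e (j + i)) = none := by
      rw [List.lookup_eq_none_iff]
      rintro ⟨k, y⟩ hky
      simp only [bne_iff_ne, ne_eq, List.mem_toFinset, List.mem_map, not_exists, not_and] at hnK ⊢
      exact fun h => hnK _ hky h.symm
    have hsome : (L j).lookup (e (j + i)) = some (Y (e (j + i))) := by
      refine List.lookup_graph Y ?_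
      refine List.mem_iff_getElem.2 ⟨i, by simpa using hi, by simp⟩
    have hsucc : K (j + 1) = K j ++ L j := hDj ▸ rfl
    simp [← hR, hsucc, List.lookup_append, hnone, hsome]

theorem exists_computable_mem_cyl {g : ℕ → ℕ} (hg : Computable g) (hmono : StrictMono g)
    {G : ℕ → List Bool} (hG : Computable G) :
    ∃ x : ℕ → Bool, Computable x ∧ ∀ n, g n + (G n).length < g (n + 1) →
      ∃ σ : List Bool, σ.length ≤ g n ∧ x ∈ Cyl (σ ++ G n) := by
  let step (n : ℕ) (τ : List Bool) : List Bool :=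
    τ ++ (G n).take (g (n + 1) - g n - 1) ++ [false]
  let X (n : ℕ) : List Bool := Nat.rec [] step n
  have hX : Computable X := by
    have hgsucc : Computable fun n => g (n + 1) := hg.comp .succ
    have hsub : Computable fun n => g (n + 1) - g n - 1 :=
      Primrec.nat_sub.to_comp.comp (Primrec.nat_sub.to_comp.comp hgsucc hg) (Computable.const 1)
    have htake : Computable fun n => (G n).take (g (n + 1) - g n - 1) :=
      Primrec.list_take.to_comp.comp hsub hG
    exact Computable.nat_rec (f := fun n : ℕ => n) (h := fun (_ : ℕ) q => step q.1 q.2)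
      Computable.id (Computable.const _)
      (Primrec.list_concat.to_comp.comp (Primrec.list_append.to_comp.comp (Computable.snd.comp .snd)
        (htake.comp (Computable.fst.comp .snd))) (Computable.const false))
  have hXlen (n : ℕ) : n ≤ (X n).length ∧ (X n).length ≤ g n := by
    induction n with
    | zero => simp [X]
    | succ n ih =>
      have : (X (n + 1)).length = (X n).length + min (g (n + 1) - g n - 1) (G n).length + 1 := by
        simp [X, step]; rfl
      have : g n < g (n + 1) := hmono (Nat.lt_succ_self n)
      omega
  have hXmono {a b : ℕ} (hab : a ≤ b) : X a <+: X b := by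
    induction hab with
    | refl => exact List.prefix_rfl
    | step _ ih => exact ih.trans ((List.prefix_append _ _).trans (List.prefix_append _ _))
  have hXget {a b i : ℕ} (hab : a ≤ b) (hi : i < (X a).length) :
      (X b).getD i false = (X a).getD i false := by
    obtain ⟨R, hR⟩ := hXmono hab
    rw [← hR, List.getD_append _ _ _ _ hi]
  let x (i : ℕ) : Bool := (X (i + 1)).getD i false
  have hx (n : ℕ) : x ∈ Cyl (X n) := fun i hi => by
    rcases le_total (i + 1) n with h | h
    · exact (hXget h (hXlen (i + 1)).1).symm
    · exact hXget h hi
  refine ⟨x, (Primrec.list_getD false).to_comp.comp (hX.comp .succ) .id, fun n hn => ?_⟩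
  refine ⟨X n, (hXlen n).2, mem_cyl_append_left (τ := [false]) ?_⟩
  have := hx (n + 1)
  simp only [X, step] at this
  rwa [List.take_of_length_le (by omega)] at this

theorem InfinitelyOftenComputable.not_weaklyMeagerEngulfing (H : InfinitelyOftenComputable A) :
    ¬ WeaklyMeagerEngulfing A := by
  rintro ⟨S, ⟨C, hC, hnd, hSC⟩, hS⟩
  obtain ⟨y, hy, hymono, hyC⟩ := hC.exists_escape hnd
  have hp : ComputableIn A fun k => k + (y k).length + 1 :=
    Primrec.succ.to_comp.compIn (Primrec.nat_add.to_comp.compIn ComputableIn.id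
      (Primrec.list_length.to_comp.compIn hy))
  obtain ⟨g, hg, hgmono, hgfreq⟩ := H.exists_frequently_le_succ hp
    (fun a b hab => Nat.succ_le_succ (add_le_add hab (hymono hab))) fun k => by omega
  have hr : ComputableIn A fun n => decide (g n + (y (g n)).length + 1 ≤ g (n + 1)) :=
    Primrec.nat_le.decide.to_comp.compIn (hp.comp (.of_computable hg))
      (.of_computable (hg.comp .succ))
  obtain ⟨G, hG, hGfreq⟩ := H.exists_frequently_eq hr (by simpa using hgfreq)
    (hy.comp (.of_computable hg))
  obtain ⟨x, hx, hxG⟩ := exists_computable_mem_cyl hg hgmono hG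
  obtain ⟨m, hm⟩ := Set.mem_iUnion.1 (hSC (hS x hx))
  obtain ⟨n, hmn, hn, hGn⟩ := frequently_atTop.1 hGfreq m
  obtain ⟨σ, hσ, hxσ⟩ := hxG n (by rw [hGn]; simpa using hn)
  exact hyC (g n) m σ (hmn.trans hgmono.le_apply) hσ x (hGn ▸ hxσ) hm

end OracleComputability

/-- `A ∈ ℬ(≠*)` (some `f ≤_T A` eventually disagrees with every total
computable function) iff `A` is weakly meager engulfing. -/
theorem stmt3 (A : Set ℕ) :
    (∃ f : ℕ → ℕ, ComputableIn A f ∧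
        ∀ h : ℕ → ℕ, Computable h → ∀ᶠ n in atTop, f n ≠ h n) ↔
    WeaklyMeagerEngulfing A := by
  refine ⟨fun ⟨f, hf, H⟩ => .of_eventually_ne hf H, fun hA => ?_⟩
  by_contra hne
  push Not at hne
  exact InfinitelyOftenComputable.not_weaklyMeagerEngulfing hne hA

end CichonAnalog
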